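/- Let X be a real normed space containing a sequence (e_i)_{i=1}^∞ with e_1 ≠ e_2 on which the norm is equal-signs-additive (ESA). Then for every integer k ≥ 1 there exist elements x, m_1, …, m_k of X with x ≠ 0 such that ‖m_j‖ = ‖x − m_j‖ = (1/2)‖x‖ for every j ∈ {1,…,k}, and ‖m_i − m_j‖ ≥ (1/4)‖x‖ for all i ≠ j; in other words, x admits k exact metric midpoints between x and 0 that are pairwise (1/4)‖x‖-separated. -/

import Mathlib

noncomputable section

/-- The sequence obtained from `a` by adding together the entries at `k` and `k+1`
(and shifting the later entries down by one). -/
def collapseSeq (a : ℕ → ℝ) (k : ℕ) : ℕ → ℝ :=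
  fun i => if i < k then a i else if i = k then a k + a (k + 1) else a (i + 1)

/-- The (finitely supported) sum `∑ᵢ aᵢ • eᵢ`. -/
def esaSum {X : Type} [AddCommGroup X] [Module ℝ X] (e : ℕ → X) (a : ℕ → ℝ) : X :=
  ∑ᶠ i, a i • e i

/-- The norm is equal-signs-additive (ESA) on the sequence `e`: collapsing two
consecutive coefficients of equal signs does not change the norm. -/
def IsESA {X : Type} [NormedAddCommGroup X] [NormedSpace ℝ X] (e : ℕ → X) : Prop :=
  ∀ a : ℕ → ℝ, (Function.support a).Finite → ∀ k : ℕ, 0 ≤ a k * a (k + 1) →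
    ‖esaSum e (collapseSeq a k)‖ = ‖esaSum e a‖

/-- The sum `∑ᵢ lᵢ • e (n + i)` over the entries of a list `l`. -/
def shiftedSum {X : Type} [AddCommGroup X] [Module ℝ X] (e : ℕ → X) : List ℝ → ℕ → X
  | [], _ => 0
  | a :: l, n => a • e n + shiftedSum e l (n + 1)

section Algebra

variable {X : Type} [AddCommGroup X] [Module ℝ X] (e : ℕ → X)

theorem shiftedSum_append (l₁ l₂ : List ℝ) (n : ℕ) :
    shiftedSum e (l₁ ++ l₂) n = shiftedSum e l₁ n + shiftedSum e l₂ (n + l₁.length) := by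
  induction l₁ generalizing n with
  | nil => simp [shiftedSum]
  | cons a l ih =>
    simp only [List.cons_append, shiftedSum, ih, List.length_cons, add_assoc]
    rw [Nat.add_comm 1]

theorem shiftedSum_replicate_zero (m n : ℕ) :
    shiftedSum e (List.replicate m 0) n = 0 := by
  induction m generalizing n with
  | zero => rfl
  | succ m ih => simp [List.replicate_succ, shiftedSum, ih]

theorem shiftedSum_eq_sum (l : List ℝ) (n : ℕ) :
    shiftedSum e l n = ∑ i ∈ Finset.range l.length, l.getD i 0 • e (n + i) := by
  induction l generalizing n with
  | nil => simp [shiftedSum]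
  | cons a l ih =>
    simp only [shiftedSum, ih, List.length_cons, Finset.sum_range_succ']
    simp [add_comm, add_left_comm]

theorem support_getD_subset (l : List ℝ) :
    (Function.support fun i => l.getD i 0) ⊆ Finset.range l.length := by
  intro i hi
  by_contra h
  simp only [Finset.coe_range, Set.mem_Iio, not_lt] at h
  exact hi (List.getD_eq_default _ _ h)

theorem esaSum_getD (l : List ℝ) :
    esaSum e (fun i => l.getD i 0) = shiftedSum e l 0 := by
  rw [shiftedSum_eq_sum, esaSum,
    finsum_eq_sum_of_support_subset (s := Finset.range l.length)]
  · simp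
  · refine subset_trans (fun i hi => ?_) (support_getD_subset l)
    intro h
    apply hi
    simp only at h
    simp only [h, zero_smul]

end Algebra

theorem collapseSeq_getD (p s : List ℝ) (a b : ℝ) :
    collapseSeq (fun i => (p ++ a :: b :: s).getD i 0) p.length =
      fun i => (p ++ (a + b) :: s).getD i 0 := by
  funext i
  unfold collapseSeq
  rcases lt_trichotomy i p.length with h | h | h
  · simp [h, List.getElem?_append_left]
  · subst h
    simp
  · obtain ⟨d, rfl⟩ := Nat.exists_eq_add_of_lt h
    have h1 : ¬ p.length + d + 1 < p.length := by omega
    have h2 : p.length + d + 1 ≠ p.length := by omega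
    have h3 : p.length + d + 1 + 1 - p.length = d + 2 := by omega
    have h4 : p.length + d + 1 - p.length = d + 1 := by omega
    simp only [if_neg h1, if_neg h2, List.getD_eq_getElem?_getD]
    rw [List.getElem?_append_right (by omega), List.getElem?_append_right (by omega), h3, h4]
    simp

/-- Replacing the consecutive coefficients `l` by `l'` never decreases the norm. -/
def NormLE {X : Type} [NormedAddCommGroup X] [NormedSpace ℝ X] (e : ℕ → X)
    (l l' : List ℝ) : Prop :=
  ∀ p s : List ℝ, ‖shiftedSum e (p ++ l ++ s) 0‖ ≤ ‖shiftedSum e (p ++ l' ++ s) 0‖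

section Norm

variable {X : Type} [NormedAddCommGroup X] [NormedSpace ℝ X] {e : ℕ → X}

namespace NormLE

theorem refl (l : List ℝ) : NormLE e l l := fun _ _ => le_rfl

theorem append {l₁ l₂ l₁' l₂' : List ℝ} (h : NormLE e l₁ l₁') (h' : NormLE e l₂ l₂') :
    NormLE e (l₁ ++ l₂) (l₁' ++ l₂') := by
  intro p s
  have h₁ := h p (l₂ ++ s)
  have h₂ := h' (p ++ l₁') s
  simp only [List.append_assoc] at h₁ h₂ ⊢
  exact h₁.trans h₂

theorem flatMap {ι : Type} {f g : ι → List ℝ} (h : ∀ b, NormLE e (f b) (g b)) (bs : List ι) :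
    NormLE e (bs.flatMap f) (bs.flatMap g) := by
  induction bs with
  | nil => exact refl _
  | cons b bs ih => exact (h b).append ih

theorem norm_le {l l' : List ℝ} (h : NormLE e l l') :
    ‖shiftedSum e l 0‖ ≤ ‖shiftedSum e l' 0‖ := by simpa using h [] []

end NormLE

theorem norm_shiftedSum_flatMap_congr {ι : Type} {f g : ι → List ℝ}
    (h : ∀ b, NormLE e (f b) (g b) ∧ NormLE e (g b) (f b)) (bs : List ι) :
    ‖shiftedSum e (bs.flatMap f) 0‖ = ‖shiftedSum e (bs.flatMap g) 0‖ :=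
  le_antisymm (NormLE.flatMap (fun b => (h b).1) bs).norm_le
    (NormLE.flatMap (fun b => (h b).2) bs).norm_le

namespace IsESA

theorem norm_merge (he : IsESA e) (p s : List ℝ) {a b : ℝ} (hab : 0 ≤ a * b) :
    ‖shiftedSum e (p ++ (a + b) :: s) 0‖ = ‖shiftedSum e (p ++ a :: b :: s) 0‖ := by
  have h := he (fun i => (p ++ a :: b :: s).getD i 0)
    ((Finset.finite_toSet _).subset (support_getD_subset _)) p.length (by simpa using hab)
  rwa [collapseSeq_getD, esaSum_getD, esaSum_getD] at h

theorem norm_zero_cons (he : IsESA e) (p s : List ℝ) :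
    ‖shiftedSum e (p ++ 0 :: s) 0‖ = ‖shiftedSum e (p ++ s) 0‖ := by
  cases s with
  | nil => simp [shiftedSum_append, shiftedSum]
  | cons b s => simpa using (he.norm_merge p s (a := 0) (b := b) (by simp)).symm

theorem norm_replicate_zero (he : IsESA e) (m : ℕ) (p s : List ℝ) :
    ‖shiftedSum e (p ++ (List.replicate m 0 ++ s)) 0‖ = ‖shiftedSum e (p ++ s) 0‖ := by
  induction m with
  | zero => simp
  | succ m ih => rw [List.replicate_succ, List.cons_append, he.norm_zero_cons, ih]

theorem norm_shift (he : IsESA e) (l : List ℝ) (n : ℕ) :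
    ‖shiftedSum e l n‖ = ‖shiftedSum e l 0‖ := by
  have h := he.norm_replicate_zero n [] l
  simpa [shiftedSum_append, shiftedSum_replicate_zero] using h

theorem norm_apply (he : IsESA e) (n : ℕ) : ‖e n‖ = ‖e 0‖ := by
  simpa [shiftedSum] using he.norm_shift [1] n

/-- Averaging the shifts of `a • (e k - e (k + 1))` through a long gap shows that this
difference can be deleted without increasing the norm. -/
theorem nil_normLE_pair (he : IsESA e) (a : ℝ) : NormLE e [] [a, -a] := by
  intro p s
  set v := ‖shiftedSum e (p ++ [a, -a] ++ s) 0‖ with hv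
  set w := ‖shiftedSum e (p ++ [] ++ s) 0‖ with hw
  set P := p.length with hP
  have key : ∀ n : ℕ, (n + 1 : ℝ) * (w - v) ≤ |a| * (‖e 0‖ + ‖e 0‖) := by
    intro n
    set R := shiftedSum e p 0 + shiftedSum e s (P + (n + 2)) with hR
    have hRn : ‖R‖ = w := by
      rw [hw, List.append_nil, ← he.norm_replicate_zero (n + 2) p s, hR]
      simp [shiftedSum_append, shiftedSum_replicate_zero, hP]
    have hj : ∀ j ∈ Finset.range (n + 1),
        ‖R - a • (e (P + (j + 1)) - e (P + j))‖ ≤ v := by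
      intro j hj
      have hjn : j ≤ n := by simpa [Nat.lt_succ_iff] using hj
      have h₁ := he.norm_replicate_zero j p ([a, -a] ++ (List.replicate (n - j) 0 ++ s))
      have h₂ := he.norm_replicate_zero (n - j) (p ++ [a, -a]) s
      rw [List.append_assoc] at h₂
      rw [hv, ← h₂, ← h₁]
      apply le_of_eq
      congr 1
      have h₃ : P + j + 2 + (n - j) = P + (n + 2) := by omega
      simp only [shiftedSum_append, shiftedSum_replicate_zero, List.length_replicate,
        List.length_cons, List.length_nil, shiftedSum, zero_add, ← hP, h₃, hR, ← add_assoc]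
      module
    have hsum : (n + 1 : ℝ) • R = (∑ j ∈ Finset.range (n + 1),
        (R - a • (e (P + (j + 1)) - e (P + j)))) + a • (e (P + (n + 1)) - e P) := by
      rw [Finset.sum_sub_distrib, ← Finset.smul_sum,
        Finset.sum_range_sub (fun j => e (P + j)), Finset.sum_const, Finset.card_range,
        ← Nat.cast_smul_eq_nsmul ℝ]
      push_cast
      simp
    have h₁ : ‖(n + 1 : ℝ) • R‖ ≤ (n + 1 : ℝ) * v + |a| * (‖e 0‖ + ‖e 0‖) := by
      rw [hsum]
      refine (norm_add_le _ _).trans (add_le_add ?_ ?_)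
      · refine (norm_sum_le_of_le _ hj).trans ?_
        simp
      · rw [norm_smul, Real.norm_eq_abs]
        gcongr
        refine (norm_sub_le _ _).trans ?_
        rw [he.norm_apply (P + (n + 1)), he.norm_apply P]
    rw [norm_smul, hRn, Real.norm_of_nonneg (by positivity)] at h₁
    linarith
  by_contra! hlt
  obtain ⟨n, hn⟩ := exists_nat_gt (|a| * (‖e 0‖ + ‖e 0‖) / (w - v))
  rw [div_lt_iff₀ (sub_pos.2 hlt)] at hn
  nlinarith [key n]

theorem nil_normLE_zero (he : IsESA e) : NormLE e [] [0] := fun p s => by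
  simpa using (he.norm_zero_cons p s).ge

theorem zero_normLE_nil (he : IsESA e) : NormLE e [0] [] := fun p s => by
  simpa using (he.norm_zero_cons p s).le

theorem add_normLE_pair (he : IsESA e) {a b : ℝ} (hab : 0 ≤ a * b) :
    NormLE e [a + b] [a, b] := fun p s => by
  simpa using (he.norm_merge p s hab).le

theorem pair_normLE_add (he : IsESA e) {a b : ℝ} (hab : 0 ≤ a * b) :
    NormLE e [a, b] [a + b] := fun p s => by
  simpa using (he.norm_merge p s hab).ge

/-- Splitting both coefficients of `c • (e 0 - e 1)` into parts of equal signs does not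
change norms. -/
theorem normLE_split (he : IsESA e) {a b c : ℝ} (hab : 0 ≤ a * b) (hc : a + b = c) :
    NormLE e [a, b, -a, -b] [c, -c] ∧ NormLE e [c, -c] [a, b, -a, -b] := by
  have hn : 0 ≤ -a * -b := by simpa using hab
  have hc' : -a + -b = -c := by linarith
  constructor
  · simpa [hc, hc'] using (he.pair_normLE_add hab).append (he.pair_normLE_add hn)
  · simpa [hc, hc'] using (he.add_normLE_pair hab).append (he.add_normLE_pair hn)

end IsESA

theorem shiftedSum_smul (c : ℝ) (l : List ℝ) (n : ℕ) :
    shiftedSum e (l.map (c * ·)) n = c • shiftedSum e l n := by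
  induction l generalizing n with
  | nil => simp [shiftedSum]
  | cons a l ih => simp [shiftedSum, ih, mul_smul]

theorem shiftedSum_flatMap_sub {ι : Type} (f g : ι → ℝ × ℝ) (bs : List ι) (n : ℕ) :
    shiftedSum e (bs.flatMap fun b => [(f b).1, (f b).2, -(f b).1, -(f b).2]) n -
      shiftedSum e (bs.flatMap fun b => [(g b).1, (g b).2, -(g b).1, -(g b).2]) n =
    shiftedSum e (bs.flatMap fun b => [(f b).1 - (g b).1, (f b).2 - (g b).2,
      -((f b).1 - (g b).1), -((f b).2 - (g b).2)]) n := by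
  induction bs generalizing n with
  | nil => simp [shiftedSum]
  | cons b bs ih =>
    simp only [List.flatMap_cons, List.cons_append, List.nil_append, shiftedSum, ← ih]
    module

/-- The coefficients of `∑_{i < n} (e (2 i) - e (2 i + 1))`. -/
def alternating (n : ℕ) : List ℝ := (List.replicate n [1, -1]).flatten

theorem flatMap_const_eq_alternating {ι : Type} (bs : List ι) :
    (bs.flatMap fun _ => [(1 : ℝ), -1]) = alternating bs.length := by
  simp [alternating, List.flatMap, List.map_const']

theorem flatMap_ite_eq_alternating {ι : Type} (P : ι → Bool) (bs : List ι) :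
    (bs.flatMap fun b => if P b then [(1 : ℝ), -1] else []) =
      alternating (bs.countP P) := by
  rw [List.countP_eq_length_filter, ← flatMap_const_eq_alternating]
  induction bs with
  | nil => rfl
  | cons b bs ih => by_cases h : P b <;> simp [h, ih]

namespace IsESA

theorem norm_alternating_add_le (he : IsESA e) (m n : ℕ) :
    ‖shiftedSum e (alternating (m + n)) 0‖ ≤
      ‖shiftedSum e (alternating m) 0‖ + ‖shiftedSum e (alternating n) 0‖ := by
  rw [alternating, List.replicate_add, List.flatten_append, shiftedSum_append]
  refine (norm_add_le _ _).trans ?_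
  rw [he.norm_shift _ (0 + _)]
  rfl

theorem norm_alternating_pos (he : IsESA e) (hne : e 0 ≠ e 1) {n : ℕ} (hn : n ≠ 0) :
    0 < ‖shiftedSum e (alternating n) 0‖ := by
  obtain ⟨n, rfl⟩ := Nat.exists_eq_succ_of_ne_zero hn
  have h : ∀ m, NormLE e [] (alternating m) := by
    intro m
    induction m with
    | zero => exact NormLE.refl _
    | succ m ih => exact (he.nil_normLE_pair 1).append ih
  have h₁ : ‖e 0 - e 1‖ ≤ ‖shiftedSum e (alternating (n + 1)) 0‖ := by
    have := ((NormLE.refl [1, -1]).append (h n)).norm_le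
    simpa [shiftedSum, alternating, List.replicate_succ, sub_eq_add_neg] using this
  exact (norm_pos_iff.2 (sub_ne_zero.2 hne)).trans_le h₁

end IsESA

end Norm

/-- Exactly half of the vertices of the Boolean cube have distinct `i`-th and `j`-th
coordinates. -/
theorem card_cube_eq_two_mul_countP {k : ℕ} {i j : Fin k} (hij : i ≠ j) :
    (Finset.univ : Finset (Fin k → Bool)).toList.length =
      (Finset.univ : Finset (Fin k → Bool)).toList.countP (fun b => b i != b j) +
      (Finset.univ : Finset (Fin k → Bool)).toList.countP (fun b => b i != b j) := by
  set bs := (Finset.univ : Finset (Fin k → Bool)).toList with hbs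
  have hcard : ∀ P : (Fin k → Bool) → Bool,
      bs.countP P = (Finset.univ.filter fun b => P b = true).card := by
    intro P
    rw [Finset.card_def, Finset.filter_val, ← Multiset.countP_eq_card_filter,
      ← Finset.coe_toList, Multiset.coe_countP, hbs]
    simp
  have hflip : bs.countP (fun b => b i != b j) = bs.countP (fun b => !(b i != b j)) := by
    rw [hcard, hcard]
    refine Finset.card_nbij' (fun b => Function.update b i (!(b i)))
      (fun b => Function.update b i (!(b i))) ?_ ?_ ?_ ?_
    · intro b hb
      have hb' : b i ≠ b j := by simpa using hb
      simp only [Finset.coe_filter, Finset.mem_univ, true_and, Set.mem_ofPred_eq,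
        Function.update_self, Function.update_of_ne hij.symm]
      revert hb'
      cases b i <;> cases b j <;> simp
    · intro b hb
      have hb' : b i = b j := by simpa using hb
      simp only [Finset.coe_filter, Finset.mem_univ, true_and, Set.mem_ofPred_eq,
        Function.update_self, Function.update_of_ne hij.symm]
      revert hb'
      cases b i <;> cases b j <;> simp
    · intro b _
      simp
    · intro b _
      simp
  refine (List.length_eq_countP_add_countP (fun b : Fin k → Bool => b i != b j)).trans ?_
  congr 1
  rw [hflip]
  refine List.countP_congr fun b _ => ?_
  cases b i <;> cases b j <;> simp

/-- In a real normed space with an ESA sequence `(eᵢ)` satisfying `e 0 ≠ e 1`, for every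
`k ≥ 1` there is a nonzero element `x` admitting `k` exact metric midpoints between `x` and
`0` that are pairwise `(1/4)‖x‖`-separated. -/
theorem esa_space_has_separated_midpoints
    (X : Type) [NormedAddCommGroup X] [NormedSpace ℝ X]
    (e : ℕ → X) (he : IsESA e) (hne : e 0 ≠ e 1) :
    ∀ k : ℕ, 1 ≤ k →
      ∃ (x : X) (m : Fin k → X), x ≠ 0 ∧
        (∀ j : Fin k, ‖m j‖ = (1 / 2) * ‖x‖ ∧ ‖x - m j‖ = (1 / 2) * ‖x‖) ∧
        (∀ i j : Fin k, i ≠ j → (1 / 4) * ‖x‖ ≤ ‖m i - m j‖) := by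
  intro k _
  set bs := (Finset.univ : Finset (Fin k → Bool)).toList with hbs
  set β := ‖shiftedSum e (alternating bs.length) 0‖ with hβ
  let u : Fin k → (Fin k → Bool) → ℝ × ℝ := fun j b => if b j then (1, 0) else (0, 1)
  let quad : ((Fin k → Bool) → ℝ × ℝ) → X := fun f =>
    shiftedSum e (bs.flatMap fun b => [(f b).1, (f b).2, -(f b).1, -(f b).2]) 0
  have hquad_sub : ∀ f g, quad f - quad g = quad (f - g) := fun f g =>
    shiftedSum_flatMap_sub f g bs 0
  have hquad_norm : ∀ f : (Fin k → Bool) → ℝ × ℝ,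
      (∀ b, 0 ≤ (f b).1 * (f b).2 ∧ (f b).1 + (f b).2 = 1) → ‖quad f‖ = β := by
    intro f hf
    rw [hβ, ← flatMap_const_eq_alternating]
    exact norm_shiftedSum_flatMap_congr (fun b => he.normLE_split (hf b).1 (hf b).2) bs
  have hx : ‖quad fun _ => (1, 1)‖ = 2 * β := by
    have h₁ : ‖quad fun _ => (1, 1)‖ =
        ‖shiftedSum e (bs.flatMap fun _ => [(2 : ℝ), -2]) 0‖ :=
      norm_shiftedSum_flatMap_congr
        (fun _ => he.normLE_split (by norm_num) (by norm_num)) bs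
    have h₂ : (bs.flatMap fun _ => [(2 : ℝ), -2]) =
        (bs.flatMap fun _ => [(1 : ℝ), -1]).map (2 * ·) := by
      simp [List.map_flatMap]
    rw [h₁, h₂, shiftedSum_smul, norm_smul, flatMap_const_eq_alternating, hβ]
    norm_num
  have hβ_pos : 0 < β := he.norm_alternating_pos hne (by simp [hbs])
  refine ⟨quad fun _ => (1, 1), fun j => quad (u j), ?_, fun j => ⟨?_, ?_⟩, ?_⟩
  · rw [← norm_pos_iff, hx]
    linarith
  · rw [hx, hquad_norm]
    · ring
    · intro b
      by_cases h : b j <;> simp [u, h]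
  · rw [hx, hquad_sub, hquad_norm]
    · ring
    · intro b
      by_cases h : b j <;> simp [u, h]
  · intro i j hij
    have h₁ : ∀ b : Fin k → Bool, NormLE e (if b i != b j then [(1 : ℝ), -1] else [])
        [((u i - u j) b).1, ((u i - u j) b).2, -((u i - u j) b).1, -((u i - u j) b).2] := by
      intro b
      have hz : NormLE e [] [0, 0, 0, 0] :=
        ((he.nil_normLE_zero.append he.nil_normLE_zero).append
          he.nil_normLE_zero).append he.nil_normLE_zero
      have hr : NormLE e [1, -1] [1, -1, -1, 1] := by
        simpa using (NormLE.refl [1, -1]).append (he.nil_normLE_pair (-1))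
      have hl : NormLE e [1, -1] [-1, 1, 1, -1] := by
        simpa using (he.nil_normLE_pair (-1)).append (NormLE.refl [1, -1])
      cases hi : b i <;> cases hj : b j <;> simp [u, hi, hj, hz, hr, hl]
    have h₂ := (NormLE.flatMap h₁ bs).norm_le
    rw [flatMap_ite_eq_alternating] at h₂
    have h₃ := he.norm_alternating_add_le
      (bs.countP fun b => b i != b j) (bs.countP fun b => b i != b j)
    rw [← card_cube_eq_two_mul_countP hij] at h₃
    rw [hx, hquad_sub]
    change _ ≤ ‖quad (u i - u j)‖ at h₂
    linarith

end
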